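/- Lipschitz continuity of the stationary VAR(∞) parameters (Theorem 3.6(ii)). Fix K < ∞, κ > 3, 0 < λ_inf ≤ λ_sup < ∞ and N₀ ∈ ℕ. There exists a constant 𝒦 < ∞, depending only on K, κ, λ_inf, λ_sup, such that whenever Assumption LS(p, K, κ, λ_inf, λ_sup, N₀) holds, for all u₁, u₂ ∈ ℝ and all j ≥ 1: ‖Σ(u₁) − Σ(u₂)‖₂ ≤ 𝒦 |u₁ − u₂| and ‖Φ_j(u₁) − Φ_j(u₂)‖₂ ≤ 𝒦 ζ(j)^{κ−1} |u₁ − u₂|. -/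

import Mathlib

noncomputable section

/-- `⟨x⟩ = max(1,|x|)` -/
def gu (x : ℝ) : ℝ := max 1 |x|

/-- `ζ(x) = max(1, log⟨x⟩)/⟨x⟩` -/
def zeta (x : ℝ) : ℝ := max 1 (Real.log (gu x)) / gu x

/-- spectral norm of a matrix -/
def specNorm {𝕜 : Type*} [RCLike 𝕜] {m n : Type*} [Fintype m] [Fintype n] [DecidableEq n]
    (M : Matrix m n 𝕜) : ℝ :=
  ‖LinearMap.toContinuousLinearMap (Matrix.toEuclideanLin M)‖

/-- `ℓ²(ι; ℝ^p)` -/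
abbrev HpI (ι : Type) (p : ℕ) : Type := lp (fun _ : ι => EuclideanSpace ℝ (Fin p)) 2

abbrev Hp (p : ℕ) : Type := HpI ℤ p

/-- the sequence `δ_t ⊗ e_a` -/
def bvec {ι : Type} [DecidableEq ι] (p : ℕ) (t : ι) (a : Fin p) : HpI ι p :=
  lp.single 2 t (EuclideanSpace.single a 1)

/-- the `p × p` block `A_{t,τ}` of an operator -/
def blk {ι : Type} [DecidableEq ι] {p : ℕ} (A : HpI ι p →L[ℝ] HpI ι p) (t τ : ι) :
    Matrix (Fin p) (Fin p) ℝ :=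
  Matrix.of fun a b => inner (𝕜 := ℝ) (bvec p t a) (A (bvec p τ b))


/-- Assumption LS(p, K, κ, λ_inf, λ_sup, N₀): a locally stationary family of covariance
operators `𝐂^(N)` together with the smooth local autocovariance functions `C_r(·)`. -/
structure AssumptionLS (p : ℕ) (K κ lamInf lamSup : ℝ) (N₀ : ℕ)
    (C : ℕ → Hp p →L[ℝ] Hp p) (Cr : ℤ → ℝ → Matrix (Fin p) (Fin p) ℝ) : Prop where
  symm : ∀ (N : ℕ) (x y : Hp p), inner (𝕜 := ℝ) ((C N) x) y = inner (𝕜 := ℝ) x ((C N) y)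
  lower : ∀ N : ℕ, N₀ ≤ N → ∀ v : Hp p, lamInf * ‖v‖ ^ 2 ≤ inner (𝕜 := ℝ) v ((C N) v)
  upper : ∀ N : ℕ, N₀ ≤ N → ∀ v : Hp p, inner (𝕜 := ℝ) v ((C N) v) ≤ lamSup * ‖v‖ ^ 2
  decay : ∀ N : ℕ, 1 ≤ N → ∀ t τ : ℤ,
    specNorm (blk (C N) t τ) ≤ K * gu ((t : ℝ) - (τ : ℝ)) ^ (-κ)
  crSymm : ∀ (r : ℤ) (u : ℝ), Cr r u = (Cr (-r) u).transpose
  crBound : ∀ (r : ℤ) (u : ℝ), specNorm (Cr r u) ≤ K * gu (r : ℝ) ^ (-κ)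
  crLip : ∀ (r : ℤ) (u v : ℝ),
    specNorm (Cr r u - Cr r v) ≤ K * |u - v| * gu (r : ℝ) ^ (-κ)
  approx : ∀ N : ℕ, 1 ≤ N → ∀ t τ : ℤ,
    specNorm (blk (C N) t τ - Cr (t - τ) ((t : ℝ) / (N : ℝ))) ≤
      K * gu ((t : ℝ) - (τ : ℝ)) ^ (-κ + 1) *
        min (1 / (N : ℝ)) (2 / gu ((t : ℝ) - (τ : ℝ)))

/-- The half-line `{t : ℤ | t ≤ 0}`. -/
abbrev HalfLine : Type := {t : ℤ // t ≤ (0 : ℤ)}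

/-- The continuous linear endomorphism of Euclidean space given by a square matrix. -/
abbrev matCLM {p : ℕ} (M : Matrix (Fin p) (Fin p) ℝ) :
    EuclideanSpace ℝ (Fin p) →L[ℝ] EuclideanSpace ℝ (Fin p) :=
  LinearMap.toContinuousLinearMap (Matrix.toEuclideanLin M)

theorem inner_single_matCLM_single {p : ℕ} (M : Matrix (Fin p) (Fin p) ℝ) (a b : Fin p) :
    inner (𝕜 := ℝ) (EuclideanSpace.single a 1) (matCLM M (EuclideanSpace.single b 1)) = M a b := by
  simp [matCLM, EuclideanSpace.inner_single_left, Matrix.toLpLin_apply]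

theorem apply_single_eq {ι : Type} [DecidableEq ι] {p : ℕ} (A : HpI ι p →L[ℝ] HpI ι p)
    (t τ : ι) (y : EuclideanSpace ℝ (Fin p)) :
    (A (lp.single 2 τ y)) t = matCLM (blk A t τ) y := by
  let F : EuclideanSpace ℝ (Fin p) →L[ℝ] EuclideanSpace ℝ (Fin p) :=
    (lp.evalCLM ℝ (fun _ : ι => EuclideanSpace ℝ (Fin p)) 2 t).comp
      (A.comp (lp.singleContinuousLinearMap ℝ (fun _ : ι => EuclideanSpace ℝ (Fin p)) 2 τ))
  have hF : F.toLinearMap = (matCLM (blk A t τ)).toLinearMap := by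
    refine (EuclideanSpace.basisFun (Fin p) ℝ).toBasis.ext fun b => ?_
    have hc : ∀ z : EuclideanSpace ℝ (Fin p), ∀ a,
        z a = inner (𝕜 := ℝ) (EuclideanSpace.single a 1) z := fun z a => by
      simp [EuclideanSpace.inner_single_left]
    refine PiLp.ext fun a => ?_
    simp only [OrthonormalBasis.coe_toBasis, EuclideanSpace.basisFun_apply,
      ContinuousLinearMap.coe_coe]
    rw [hc _ a, hc _ a, inner_single_matCLM_single]
    change _ = inner (𝕜 := ℝ) (bvec p t a) (A (bvec p τ b))
    unfold bvec
    rw [lp.inner_single_left]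
    rfl
  exact congrArg (fun G => G y) hF

theorem specNorm_blk_le {ι : Type} [DecidableEq ι] {p : ℕ} (A : HpI ι p →L[ℝ] HpI ι p) (t τ : ι) :
    specNorm (blk A t τ) ≤ ‖A‖ := by
  refine ContinuousLinearMap.opNorm_le_bound _ (norm_nonneg _) fun y => ?_
  have h := apply_single_eq A t τ y
  calc ‖matCLM (blk A t τ) y‖ = ‖(A (lp.single 2 τ y)) t‖ := by rw [h]
    _ ≤ ‖A (lp.single 2 τ y)‖ := lp.norm_apply_le_norm (by norm_num) _ _
    _ ≤ ‖A‖ * ‖(lp.single 2 τ y : HpI ι p)‖ := A.le_opNorm _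
    _ = ‖A‖ * ‖y‖ := by rw [lp.norm_single (by norm_num)]

theorem blk_sub {ι : Type} [DecidableEq ι] {p : ℕ} (A B : HpI ι p →L[ℝ] HpI ι p) (t τ : ι) :
    blk (A - B) t τ = blk A t τ - blk B t τ := by
  ext a b
  simp [blk, inner_sub_right]

/-- Operators on `ℓ²` are determined by their blocks. -/
theorem ext_of_apply_single {ι : Type} [DecidableEq ι] {p : ℕ} {A B : HpI ι p →L[ℝ] HpI ι p}
    (h : ∀ t τ y, (A (lp.single 2 τ y)) t = (B (lp.single 2 τ y)) t) : A = B := by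
  ext1 v
  have hv := lp.hasSum_single (p := 2) (by norm_num) v
  have h1 := hv.mapL A
  have h2 := hv.mapL B
  have : (fun i => A (lp.single 2 i (v i))) = fun i => B (lp.single 2 i (v i)) := by
    funext i
    exact lp.ext (funext fun t => h t i _)
  rw [this] at h1
  exact h1.unique h2

/-- Extension by zero of a sequence on the half-line to `ℤ`. -/
def extendZero {p : ℕ} (v : HpI HalfLine p) (s : ℤ) : EuclideanSpace ℝ (Fin p) :=
  if h : s ≤ 0 then v ⟨s, h⟩ else 0

theorem hasSum_norm_sq_extendZero {p : ℕ} (v : HpI HalfLine p) :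
    HasSum (fun s => ‖extendZero v s‖ ^ 2) (‖v‖ ^ 2) := by
  have h1 : HasSum (fun t => ‖v t‖ ^ 2) (‖v‖ ^ 2) := by
    have := lp.hasSum_norm (p := 2) (by norm_num) v
    simpa using this
  refine (Function.Injective.hasSum_iff (f := fun s => ‖extendZero v s‖ ^ 2)
    (g := ((↑) : HalfLine → ℤ)) Subtype.val_injective ?_).1 ?_
  · intro x hx
    have : ¬ x ≤ 0 := fun h => hx ⟨⟨x, h⟩, rfl⟩
    simp [extendZero, this]
  · convert h1 using 2 with t
    simp [extendZero, t.2]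

/-- The operator with a single block diagonal, `τ = t - r`, of norm at most `c`. -/
theorem exists_diagonal {p : ℕ} (r : ℤ) {c : ℝ} (hc : 0 ≤ c)
    (M : HalfLine → EuclideanSpace ℝ (Fin p) →L[ℝ] EuclideanSpace ℝ (Fin p))
    (hM : ∀ t : HalfLine, ‖M t‖ ≤ c) :
    ∃ T : HpI HalfLine p →L[ℝ] HpI HalfLine p, ‖T‖ ≤ c ∧
      ∀ v t, (T v) t = M t (extendZero v (t - r)) := by
  have hinj : Function.Injective fun t : HalfLine => (t : ℤ) - r := fun a b h =>
    Subtype.ext (by simpa using h)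
  have hpt : ∀ (v : HpI HalfLine p) (t : HalfLine),
      ‖M t (extendZero v (t - r))‖ ^ 2 ≤ c ^ 2 * ‖extendZero v (t - r)‖ ^ 2 := fun v t => by
    rw [← mul_pow]
    gcongr
    exact (M t).le_of_opNorm_le (hM t) _
  have hs : ∀ v : HpI HalfLine p,
      Summable fun t : HalfLine => c ^ 2 * ‖extendZero v (t - r)‖ ^ 2 := fun v =>
    ((hasSum_norm_sq_extendZero v).summable.comp_injective hinj).mul_left _
  have hs' : ∀ v : HpI HalfLine p,
      Summable fun t : HalfLine => ‖M t (extendZero v (t - r))‖ ^ 2 := fun v =>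
    Summable.of_nonneg_of_le (fun _ => by positivity) (hpt v) (hs v)
  have hmem : ∀ v : HpI HalfLine p,
      Memℓp (fun t : HalfLine => M t (extendZero v (t - r))) 2 := fun v => by
    refine memℓp_gen ?_
    simpa using hs' v
  let T₀ : HpI HalfLine p →ₗ[ℝ] HpI HalfLine p :=
    { toFun := fun v => ⟨_, hmem v⟩
      map_add' := fun v w => by
        refine lp.ext (funext fun t => ?_)
        have : extendZero (v + w) (t - r) = extendZero v (t - r) + extendZero w (t - r) := by
          unfold extendZero; split_ifs <;> simp
        change M t (extendZero (v + w) (t - r)) = M t _ + M t _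
        rw [this, map_add]
      map_smul' := fun k v => by
        refine lp.ext (funext fun t => ?_)
        have : extendZero (k • v) (t - r) = k • extendZero v (t - r) := by
          unfold extendZero; split_ifs <;> simp
        change M t (extendZero (k • v) (t - r)) = k • M t _
        rw [this, map_smul] }
  have hb : ∀ v, ‖T₀ v‖ ≤ c * ‖v‖ := fun v => by
    refine abs_le_of_sq_le_sq' ?_ (by positivity) |>.2
    have h1 : ‖T₀ v‖ ^ 2 = ∑' t : HalfLine, ‖M t (extendZero v (t - r))‖ ^ 2 := by
      have := lp.norm_rpow_eq_tsum (p := 2) (by norm_num) (T₀ v)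
      simp only [ENNReal.toReal_ofNat, Real.rpow_ofNat] at this
      exact this
    rw [h1, mul_pow]
    calc _ ≤ ∑' t : HalfLine, c ^ 2 * ‖extendZero v (t - r)‖ ^ 2 :=
          Summable.tsum_le_tsum (hpt v) (hs' v) (hs v)
      _ = c ^ 2 * ∑' t : HalfLine, ‖extendZero v (t - r)‖ ^ 2 := tsum_mul_left
      _ ≤ c ^ 2 * ∑' s : ℤ, ‖extendZero v s‖ ^ 2 := by
          gcongr
          exact tsum_comp_le_tsum_of_inj (hasSum_norm_sq_extendZero v).summable
            (fun _ => by positivity) hinj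
      _ = c ^ 2 * ‖v‖ ^ 2 := by rw [(hasSum_norm_sq_extendZero v).tsum_eq]
  exact ⟨T₀.mkContinuous c hb, T₀.mkContinuous_norm_le hc hb, fun v t => rfl⟩

/-- Schur-type construction: blocks dominated by a summable function of the distance to the
diagonal define a bounded operator. -/
theorem exists_operator_of_blocks {p : ℕ} {a : ℤ → ℝ} (ha : Summable a)
    (M : HalfLine → HalfLine → Matrix (Fin p) (Fin p) ℝ)
    (hM : ∀ t τ : HalfLine, specNorm (M t τ) ≤ a (t - τ)) (ha0 : ∀ r, 0 ≤ a r) :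
    ∃ T : HpI HalfLine p →L[ℝ] HpI HalfLine p, ‖T‖ ≤ ∑' r, a r ∧
      ∀ t τ y, (T (lp.single 2 τ y)) t = matCLM (M t τ) y := by
  have hM' : ∀ (r : ℤ) (t : HalfLine),
      ‖(if h : (t : ℤ) - r ≤ 0 then matCLM (M t ⟨t - r, h⟩) else 0)‖ ≤ a r := fun r t => by
    split_ifs with h
    · have := hM t ⟨t - r, h⟩
      rwa [sub_sub_cancel] at this
    · simpa using ha0 r
  choose D hD hDv using fun r : ℤ => exists_diagonal r (ha0 r) _ (hM' r)
  have hDs : Summable D := Summable.of_norm_bounded ha hD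
  refine ⟨∑' r, D r, tsum_of_norm_bounded ha.hasSum hD, fun t τ y => ?_⟩
  have h1 : HasSum (fun r => (D r (lp.single 2 τ y)) t) ((∑' r, D r) (lp.single 2 τ y) t) := by
    have := hDs.hasSum.mapL (ContinuousLinearMap.apply ℝ (HpI HalfLine p)
      (lp.single 2 τ y : HpI HalfLine p))
    exact this.mapL (lp.evalCLM ℝ (fun _ : HalfLine => EuclideanSpace ℝ (Fin p)) 2 t)
  refine h1.unique ?_
  have h2 : matCLM (M t τ) y = (D ((t : ℤ) - τ) (lp.single 2 τ y)) t := by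
    rw [hDv]
    have e : (t : ℤ) - (t - τ) = τ := by ring
    have h0 : (t : ℤ) - (t - τ) ≤ 0 := by rw [e]; exact τ.2
    have e' : (⟨(t : ℤ) - (t - τ), h0⟩ : HalfLine) = τ := Subtype.ext e
    simp only [extendZero, h0, dif_pos, e', lp.single_apply_self]
  rw [h2]
  refine hasSum_single _ fun r hr => ?_
  rw [hDv]
  have : extendZero (lp.single 2 τ y : HpI HalfLine p) (t - r) = 0 := by
    unfold extendZero
    split_ifs with h
    · refine lp.single_apply_ne (E := fun _ => EuclideanSpace ℝ (Fin p)) 2 τ y fun e => hr ?_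
      have := congrArg Subtype.val e
      simp only at this
      omega
    · rfl
  rw [this, map_zero]

theorem norm_le_tsum_of_blocks {p : ℕ} {a : ℤ → ℝ} (ha : Summable a) (ha0 : ∀ r, 0 ≤ a r)
    (A : HpI HalfLine p →L[ℝ] HpI HalfLine p)
    (hA : ∀ t τ : HalfLine, specNorm (blk A t τ) ≤ a (t - τ)) : ‖A‖ ≤ ∑' r, a r := by
  obtain ⟨T, hT, hTb⟩ := exists_operator_of_blocks ha (blk A) hA ha0
  have : A = T := ext_of_apply_single fun t τ y => by rw [hTb, apply_single_eq]
  rwa [this]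

/-- All blocks at distance more than `m` from the diagonal vanish. -/
def Banded {p : ℕ} (A : HpI HalfLine p →L[ℝ] HpI HalfLine p) (m : ℕ) : Prop :=
  ∀ t τ : HalfLine, (m : ℤ) < |(t : ℤ) - τ| → ∀ y, (A (lp.single 2 τ y)) t = 0

namespace Banded

variable {p : ℕ} {A B : HpI HalfLine p →L[ℝ] HpI HalfLine p} {m n : ℕ}

theorem mono (hA : Banded A m) (h : m ≤ n) : Banded A n := fun t τ ht y =>
  hA t τ (lt_of_le_of_lt (by exact_mod_cast h) ht) y

theorem zero (m : ℕ) : Banded (0 : HpI HalfLine p →L[ℝ] HpI HalfLine p) m := fun t τ _ y => by simp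

theorem one (m : ℕ) : Banded (1 : HpI HalfLine p →L[ℝ] HpI HalfLine p) m := fun t τ h y => by
  refine lp.single_apply_ne (E := fun _ => EuclideanSpace ℝ (Fin p)) 2 τ y fun e => ?_
  subst e
  simp at h
  omega

theorem smul (c : ℝ) (hA : Banded A m) : Banded (c • A) m := fun t τ h y => by
  simp [hA t τ h y]

theorem add (hA : Banded A m) (hB : Banded B m) : Banded (A + B) m := fun t τ h y => by
  simp [hA t τ h y, hB t τ h y]

theorem sub (hA : Banded A m) (hB : Banded B m) : Banded (A - B) m := fun t τ h y => by
  simp [hA t τ h y, hB t τ h y]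

theorem mul (hA : Banded A m) (hB : Banded B n) : Banded (A * B) (m + n) := fun t τ h y => by
  set w := B (lp.single 2 τ y) with hw
  have h1 : HasSum (fun s => (A (lp.single 2 s (w s))) t) ((A w) t) :=
    ((lp.hasSum_single (p := 2) (by norm_num) w).mapL A).mapL
      (lp.evalCLM ℝ (fun _ : HalfLine => EuclideanSpace ℝ (Fin p)) 2 t)
  refine h1.unique ?_
  convert hasSum_zero with s
  by_cases hs : (n : ℤ) < |(s : ℤ) - τ|
  · rw [hw, hB s τ hs y]
    simp
  · refine hA t s ?_ _
    have := abs_sub_le (t : ℤ) s τ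
    push_cast at h
    omega

theorem pow (hA : Banded A m) (k : ℕ) : Banded (A ^ k) (k * m) := by
  induction k with
  | zero => exact one _
  | succ k ih => rw [pow_succ, Nat.succ_mul]; exact ih.mul hA

theorem geom_sum (hA : Banded A m) (k : ℕ) :
    Banded (∑ i ∈ Finset.range (k + 1), A ^ i) (k * m) := by
  induction k with
  | zero => simpa using one (p := p) 0
  | succ k ih =>
    rw [Finset.sum_range_succ]
    exact (ih.mono (Nat.mul_le_mul_right _ (Nat.le_succ k))).add (hA.pow _)

theorem specNorm_blk_le_norm_sub (hB : Banded B m) {t τ : HalfLine}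
    (h : (m : ℤ) < |(t : ℤ) - τ|) : specNorm (blk A t τ) ≤ ‖A - B‖ := by
  have h0 : blk B t τ = 0 := by
    ext a b
    change inner (𝕜 := ℝ) (bvec p t a) (B (bvec p τ b)) = 0
    unfold bvec
    rw [lp.inner_single_left, hB t τ h, inner_zero_right]
  have := specNorm_blk_le (A - B) t τ
  rwa [blk_sub, h0, sub_zero] at this

end Banded

theorem one_le_gu (x : ℝ) : 1 ≤ gu x := le_max_left _ _

theorem gu_pos (x : ℝ) : 0 < gu x := zero_lt_one.trans_le (one_le_gu x)

theorem gu_natCast {j : ℕ} (hj : 1 ≤ j) : gu (j : ℝ) = j := by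
  have : (1 : ℝ) ≤ j := by exact_mod_cast hj
  unfold gu
  rw [abs_of_nonneg (by linarith), max_eq_right this]

theorem zeta_pos (x : ℝ) : 0 < zeta x :=
  div_pos (zero_lt_one.trans_le (le_max_left _ _)) (gu_pos x)

theorem zeta_le_one (x : ℝ) : zeta x ≤ 1 := by
  unfold zeta
  rw [div_le_one (gu_pos x)]
  exact max_le (one_le_gu x) ((Real.log_le_sub_one_of_pos (gu_pos x)).trans (by linarith))

theorem rpow_neg_le_sub {κ k : ℝ} (hκ : 2 ≤ κ) (hk : 1 ≤ k) :
    k ^ (-κ) ≤ 2 ^ κ * (k ^ (-(κ - 1)) - (k + 1) ^ (-(κ - 1))) := by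
  have hk0 : 0 < k := by linarith
  have h1 : 1 + (κ - 1) * (1 / k) ≤ (1 + 1 / k) ^ (κ - 1) :=
    one_add_mul_self_le_rpow_one_add (by have : 0 < 1 / k := by positivity
                                         linarith) (by linarith)
  have h2 : k ^ (-(κ - 1)) = (k + 1) ^ (-(κ - 1)) * (1 + 1 / k) ^ (κ - 1) := by
    have : 1 + 1 / k = (k + 1) / k := by field_simp
    rw [this, Real.div_rpow (by linarith) hk0.le, Real.rpow_neg hk0.le,
      Real.rpow_neg (by linarith : 0 ≤ k + 1)]
    have := Real.rpow_pos_of_pos (by linarith : 0 < k + 1) (κ - 1)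
    field_simp
  have hP : 0 < (k + 1) ^ (-(κ - 1)) := Real.rpow_pos_of_pos (by linarith) _
  have h3 : (k + 1) ^ (-(κ - 1)) * (1 / k) ≤ k ^ (-(κ - 1)) - (k + 1) ^ (-(κ - 1)) := by
    have hq : 1 / k ≤ (κ - 1) * (1 / k) := by
      have : 0 < 1 / k := by positivity
      nlinarith
    have : (k + 1) ^ (-(κ - 1)) * (1 + 1 / k) ≤ k ^ (-(κ - 1)) := by
      rw [h2]
      gcongr
      linarith
    linarith
  have h4 : (2 * k) ^ (-(κ - 1)) ≤ (k + 1) ^ (-(κ - 1)) :=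
    Real.rpow_le_rpow_of_nonpos (by linarith) (by linarith) (by linarith)
  calc k ^ (-κ) = 2 ^ (κ - 1) * ((2 * k) ^ (-(κ - 1)) * (1 / k)) := by
        rw [Real.mul_rpow (by norm_num) hk0.le, Real.rpow_neg (by norm_num : (0:ℝ) ≤ 2),
          one_div, ← Real.rpow_neg_one k, mul_assoc, ← Real.rpow_add hk0]
        have := Real.rpow_pos_of_pos (by norm_num : (0:ℝ) < 2) (κ - 1)
        field_simp
        congr 1
        ring
    _ ≤ 2 ^ κ * (k ^ (-(κ - 1)) - (k + 1) ^ (-(κ - 1))) := by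
        have h5 : (2:ℝ) ^ (κ - 1) ≤ 2 ^ κ :=
          Real.rpow_le_rpow_of_exponent_le (by norm_num) (by linarith)
        have h6 : 0 ≤ (2 * k) ^ (-(κ - 1)) * (1 / k) := by positivity
        refine mul_le_mul h5 (le_trans ?_ h3) h6 (by positivity)
        gcongr

/-- The part of the weight `⟨r⟩^{-κ}` living at distance more than `m` from the diagonal. -/
def tailWeight (κ : ℝ) (m : ℕ) (r : ℤ) : ℝ := if (m : ℤ) < |r| then gu (r : ℝ) ^ (-κ) else 0

theorem tailWeight_nonneg (κ : ℝ) (m : ℕ) (r : ℤ) : 0 ≤ tailWeight κ m r := by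
  unfold tailWeight
  split_ifs
  · exact Real.rpow_nonneg (gu_pos _).le _
  · exact le_rfl

theorem tailWeight_neg (κ : ℝ) (m : ℕ) (r : ℤ) : tailWeight κ m (-r) = tailWeight κ m r := by
  simp [tailWeight, gu]

theorem sum_range_tailWeight_le {κ : ℝ} (hκ : 2 ≤ κ) (m : ℕ) (i N : ℕ) :
    ∑ k ∈ Finset.range N, tailWeight κ m ((k + i : ℕ) : ℤ) ≤
      2 ^ κ * ((m : ℝ) + 1) ^ (-(κ - 1)) := by
  let g : ℕ → ℝ := fun k => 2 ^ κ * (max ((k : ℝ) + i) (m + 1)) ^ (-(κ - 1))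
  have hm : ∀ k : ℕ, 0 < max ((k : ℝ) + i) (m + 1) := fun k =>
    lt_max_of_lt_right (by positivity)
  have hstep : ∀ k : ℕ, tailWeight κ m ((k + i : ℕ) : ℤ) ≤ g k - g (k + 1) := fun k => by
    unfold tailWeight
    split_ifs with h
    · rw [abs_of_nonneg (by positivity)] at h
      have h' : m + 1 ≤ k + i := by exact_mod_cast h
      have h'' : (m : ℝ) + 1 ≤ k + i := by exact_mod_cast h'
      have e1 : max ((k : ℝ) + i) (m + 1) = (k : ℝ) + i := max_eq_left h''
      have e2 : max (((k + 1 : ℕ) : ℝ) + i) (m + 1) = ((k : ℝ) + i) + 1 := by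
        rw [max_eq_left] <;> push_cast <;> linarith
      have e3 : gu (((k + i : ℕ) : ℤ) : ℝ) = (k : ℝ) + i := by
        have := gu_natCast (j := k + i) (by omega)
        push_cast at this ⊢
        exact this
      simp only [g]
      rw [e1, e2, e3, ← mul_sub]
      exact rpow_neg_le_sub hκ (by have : (0:ℝ) ≤ m := by positivity
                                   linarith)
    · rw [sub_nonneg]
      simp only [g]
      gcongr 2 ^ κ * ?_
      refine Real.rpow_le_rpow_of_nonpos (hm k) ?_ (by linarith)
      gcongr
      linarith
  have hg : ∀ k, 0 ≤ g k := fun k => mul_nonneg (by positivity) (Real.rpow_nonneg (hm k).le _)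
  calc _ ≤ ∑ k ∈ Finset.range N, (g k - g (k + 1)) := Finset.sum_le_sum fun k _ => hstep k
    _ = g 0 - g N := Finset.sum_range_sub' g N
    _ ≤ g 0 := by linarith [hg N]
    _ ≤ _ := by
      simp only [g]
      gcongr 2 ^ κ * ?_
      exact Real.rpow_le_rpow_of_nonpos (by positivity) (le_max_right _ _) (by linarith)

theorem summable_tailWeight_and_tsum_le {κ : ℝ} (hκ : 2 ≤ κ) (m : ℕ) :
    Summable (tailWeight κ m) ∧
      ∑' r, tailWeight κ m r ≤ 2 * 2 ^ κ * ((m : ℝ) + 1) ^ (-(κ - 1)) := by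
  have hb0 := sum_range_tailWeight_le hκ m 0
  have hb1 := sum_range_tailWeight_le hκ m 1
  have hn : ∀ n : ℕ, tailWeight κ m (-((n : ℤ) + 1)) = tailWeight κ m ((n + 1 : ℕ) : ℤ) :=
    fun n => by rw [tailWeight_neg]; push_cast; rfl
  have hs0 : Summable fun n : ℕ => tailWeight κ m (n : ℤ) :=
    summable_of_sum_range_le (fun _ => tailWeight_nonneg _ _ _) hb0
  have hs1 : Summable fun n : ℕ => tailWeight κ m (-((n : ℤ) + 1)) := by
    simp_rw [hn]
    exact summable_of_sum_range_le (fun _ => tailWeight_nonneg _ _ _) hb1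
  refine ⟨Summable.of_nat_of_neg_add_one hs0 hs1, ?_⟩
  rw [tsum_of_nat_of_neg_add_one hs0 hs1]
  have h0 : ∑' n : ℕ, tailWeight κ m (n : ℤ) ≤ 2 ^ κ * ((m : ℝ) + 1) ^ (-(κ - 1)) :=
    Real.tsum_le_of_sum_range_le (fun _ => tailWeight_nonneg _ _ _) hb0
  have h1 : ∑' n : ℕ, tailWeight κ m (-((n : ℤ) + 1)) ≤ 2 ^ κ * ((m : ℝ) + 1) ^ (-(κ - 1)) := by
    simp_rw [hn]
    exact Real.tsum_le_of_sum_range_le (fun _ => tailWeight_nonneg _ _ _) hb1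
  linarith

theorem summable_gu_rpow_neg {κ : ℝ} (hκ : 2 ≤ κ) : Summable fun r : ℤ => gu (r : ℝ) ^ (-κ) := by
  refine (summable_congr_cofinite ?_).2 (summable_tailWeight_and_tsum_le hκ 0).1
  refine Filter.eventually_cofinite.2 ((Set.finite_singleton (0 : ℤ)).subset fun r hr => ?_)
  by_contra h
  exact hr (by simp [tailWeight, abs_pos.2 (show r ≠ 0 from h)])

/-- Compromise between the Neumann truncation order `n` and the bandwidth `m`. -/
theorem exists_order_bandwidth {s q : ℝ} (hs : 0 < s) (hq0 : 0 < q) (hq1 : q < 1) :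
    ∃ c : ℝ, 0 < c ∧ ∀ j : ℕ, 1 ≤ j → ∃ n m : ℕ, (2 * n + 1) * m < j ∧
      q ^ (n + 1) ≤ zeta j ^ s ∧ ((m : ℝ) + 1) ^ (-s) ≤ c * zeta j ^ s := by
  set l := -Real.log q with hl
  have hl0 : 0 < l := by have := Real.log_neg hq0 hq1; linarith
  set β := s / l with hβ
  have hβ0 : 0 < β := by positivity
  refine ⟨(2 * (β + 2)) ^ s, by positivity, fun j hj => ?_⟩
  have hj1 : (1 : ℝ) ≤ j := by exact_mod_cast hj
  have hj0 : (0 : ℝ) < j := by linarith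
  have hlog : 0 ≤ Real.log j := Real.log_nonneg hj1
  set n := ⌈β * Real.log j⌉₊ with hn
  have hn1 : β * Real.log j ≤ n := Nat.le_ceil _
  have hn2 : (n : ℝ) < β * Real.log j + 1 := Nat.ceil_lt_add_one (by positivity)
  have hz : zeta j = max 1 (Real.log j) / j := by unfold zeta; rw [gu_natCast hj]
  refine ⟨n, j / (2 * (n + 1)), ?_, ?_, ?_⟩
  · have h1 : j / (2 * (n + 1)) * (2 * (n + 1)) ≤ j := Nat.div_mul_le_self _ _
    rcases Nat.eq_zero_or_pos (j / (2 * (n + 1))) with h0 | h0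
    · rw [h0]; omega
    · nlinarith
  · calc q ^ (n + 1) ≤ q ^ n := pow_le_pow_of_le_one hq0.le hq1.le (Nat.le_succ n)
      _ = q ^ (n : ℝ) := (Real.rpow_natCast q n).symm
      _ ≤ q ^ (β * Real.log j) := Real.rpow_le_rpow_of_exponent_ge hq0 hq1.le hn1
      _ = (1 / (j : ℝ)) ^ s := by
          rw [Real.rpow_def_of_pos hq0, Real.rpow_def_of_pos (by positivity), one_div, Real.log_inv]
          congr 1
          have : Real.log q = -l := by rw [hl]; ring
          rw [this, hβ]
          field_simp
      _ ≤ zeta j ^ s := by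
          rw [hz]
          gcongr
          exact le_max_left _ _
  · have hmax : (1 : ℝ) ≤ max 1 (Real.log j) := le_max_left _ _
    have hmax' : Real.log j ≤ max 1 (Real.log j) := le_max_right _ _
    have h1 : (j : ℝ) / (2 * (n + 1)) ≤ ((j / (2 * (n + 1)) : ℕ) : ℝ) + 1 := by
      have := Nat.lt_floor_add_one ((j : ℝ) / ((2 * (n + 1) : ℕ) : ℝ))
      rw [Nat.floor_div_eq_div] at this
      push_cast at this
      exact this.le
    have h2 : (0:ℝ) < j / (2 * (n + 1)) := by positivity
    calc _ ≤ ((j : ℝ) / (2 * (n + 1))) ^ (-s) :=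
          Real.rpow_le_rpow_of_nonpos h2 h1 (by linarith)
      _ = ((2 * (n + 1)) / (j : ℝ)) ^ s := by
          rw [Real.rpow_neg h2.le, ← Real.inv_rpow h2.le, inv_div]
      _ ≤ (2 * (β + 2) * zeta j) ^ s := by
          have h3 := mul_le_mul_of_nonneg_left hmax' hβ0.le
          have h4 : 2 * ((n : ℝ) + 1) ≤ 2 * (β + 2) * max 1 (Real.log j) := by linarith
          rw [hz, ← mul_div_assoc]
          exact Real.rpow_le_rpow (by positivity)
            (div_le_div_of_nonneg_right h4 hj0.le) hs.le
      _ = _ := Real.mul_rpow (by positivity) (zeta_pos _).le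

section Neumann

variable {H : Type*} [NormedAddCommGroup H] [InnerProductSpace ℝ H]

theorem norm_one_sub_smul_le_sqrt {A : H →L[ℝ] H} {l L : ℝ} (hl : 0 < l) (hlL : l ≤ L)
    (hA : ∀ v, l * ‖v‖ ^ 2 ≤ inner (𝕜 := ℝ) v (A v)) (hL : ‖A‖ ≤ L) :
    ‖1 - (l / L ^ 2) • A‖ ≤ √(1 - l ^ 2 / L ^ 2) := by
  have hL0 : 0 < L := hl.trans_le hlL
  have hx : 0 ≤ 1 - l ^ 2 / L ^ 2 := by
    rw [sub_nonneg, div_le_one (by positivity)]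
    gcongr
  refine ContinuousLinearMap.opNorm_le_bound _ (Real.sqrt_nonneg _) fun v => ?_
  refine abs_le_of_sq_le_sq' ?_ (by positivity) |>.2
  rw [mul_pow, Real.sq_sqrt hx]
  have h1 : ‖A v‖ ≤ L * ‖v‖ := A.le_of_opNorm_le hL v
  have h2 : ‖A v‖ ^ 2 ≤ L ^ 2 * ‖v‖ ^ 2 := by rw [← mul_pow]; gcongr
  change ‖v - (l / L ^ 2) • A v‖ ^ 2 ≤ _
  rw [norm_sub_sq_real, inner_smul_right, norm_smul, mul_pow, Real.norm_eq_abs, sq_abs]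
  have h3 : (l / L ^ 2) ^ 2 * ‖A v‖ ^ 2 ≤ (l / L ^ 2) ^ 2 * (L ^ 2 * ‖v‖ ^ 2) := by gcongr
  have h4 : l / L ^ 2 * (l * ‖v‖ ^ 2) ≤ l / L ^ 2 * inner (𝕜 := ℝ) v (A v) := by
    gcongr
    exact hA v
  have e3 : (l / L ^ 2) ^ 2 * (L ^ 2 * ‖v‖ ^ 2) = l ^ 2 / L ^ 2 * ‖v‖ ^ 2 := by field_simp
  have e4 : l / L ^ 2 * (l * ‖v‖ ^ 2) = l ^ 2 / L ^ 2 * ‖v‖ ^ 2 := by field_simp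
  rw [e3] at h3
  rw [e4] at h4
  linarith

theorem norm_le_inv_of_coercive {A D : H →L[ℝ] H} {l : ℝ} (hl : 0 < l)
    (hA : ∀ v, l * ‖v‖ ^ 2 ≤ inner (𝕜 := ℝ) v (A v)) (hAD : A * D = 1) : ‖D‖ ≤ l⁻¹ := by
  refine ContinuousLinearMap.opNorm_le_bound _ (by positivity) fun v => ?_
  have h1 : A (D v) = v := congrArg (fun F : H →L[ℝ] H => F v) hAD
  have h2 := hA (D v)
  rw [h1] at h2
  have h3 : l * ‖D v‖ ^ 2 ≤ ‖D v‖ * ‖v‖ := h2.trans (real_inner_le_norm _ _)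
  rw [inv_mul_eq_div, le_div_iff₀ hl]
  rcases (norm_nonneg (D v)).eq_or_lt with h0 | h0
  · rw [← h0]; simp
  · nlinarith

/-- Truncated Neumann series of a perturbation `G` of `1 - c A` as approximate inverses of `A`. -/
theorem norm_sub_smul_geom_sum_le {A D G : H →L[ℝ] H} {c q ε : ℝ}
    (hDA : D * A = 1) (hG : ‖G‖ ≤ q) (hq0 : 0 ≤ q) (hq1 : q < 1) (hε : ‖1 - c • A - G‖ ≤ ε)
    (n : ℕ) :
    ‖D - c • ∑ i ∈ Finset.range (n + 1), G ^ i‖ ≤ ‖D‖ * (q ^ (n + 1) + ε * (1 - q)⁻¹) := by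
  set S := ∑ i ∈ Finset.range (n + 1), G ^ i with hS
  have hSG : G * S = S + G ^ (n + 1) - 1 := by
    have := mul_neg_geom_sum G (n + 1)
    rw [← hS, sub_mul, one_mul] at this
    rw [← sub_eq_zero] at this ⊢
    rw [← neg_eq_zero, ← this]
    abel
  have hpow : ∀ k : ℕ, ‖G ^ k‖ ≤ q ^ k := fun k => by
    induction k with
    | zero => rw [pow_zero, pow_zero]; exact ContinuousLinearMap.norm_id_le
    | succ k ih =>
      rw [pow_succ, pow_succ]
      exact (norm_mul_le _ _).trans (mul_le_mul ih hG (norm_nonneg _) (by positivity))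
  have hSn : ‖S‖ ≤ (1 - q)⁻¹ := by
    calc ‖S‖ ≤ ∑ i ∈ Finset.range (n + 1), q ^ i :=
          norm_sum_le_of_le _ fun i _ => hpow i
      _ ≤ ∑' i, q ^ i := (summable_geometric_of_lt_one hq0 hq1).sum_le_tsum _
          fun i _ => by positivity
      _ = _ := tsum_geometric_of_lt_one hq0 hq1
  have key : D - c • S = D * (G ^ (n + 1) + (1 - c • A - G) * S) := by
    have e1 : (1 - c • A - G) * S = 1 - G ^ (n + 1) - c • (A * S) := by
      rw [sub_mul, sub_mul, one_mul, hSG, smul_mul_assoc]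
      abel
    rw [e1]
    have e2 : D * (G ^ (n + 1) + (1 - G ^ (n + 1) - c • (A * S))) = D - c • (D * A * S) := by
      rw [add_sub_assoc', add_sub_cancel, mul_sub, mul_one, mul_smul_comm, mul_assoc]
    rw [e2, hDA, one_mul]
  rw [key]
  refine (norm_mul_le _ _).trans ?_
  gcongr
  refine (norm_add_le _ _).trans (add_le_add (hpow _) ((norm_mul_le _ _).trans ?_))
  exact mul_le_mul hε hSn (norm_nonneg _) ((norm_nonneg _).trans hε)

end Neumann

theorem blk_eq_of_apply_single {p : ℕ} {T : HpI HalfLine p →L[ℝ] HpI HalfLine p}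
    {M : Matrix (Fin p) (Fin p) ℝ} {t τ : HalfLine}
    (h : ∀ y, (T (lp.single 2 τ y)) t = matCLM M y) : blk T t τ = M := by
  ext a b
  change inner (𝕜 := ℝ) (bvec p t a) (T (bvec p τ b)) = _
  unfold bvec
  rw [lp.inner_single_left, h, inner_single_matCLM_single]

theorem exists_banded_truncation {p : ℕ} {κ k : ℝ} (hκ : 2 ≤ κ) (hk : 0 ≤ k) (m : ℕ)
    (A : HpI HalfLine p →L[ℝ] HpI HalfLine p)
    (hA : ∀ t τ : HalfLine, specNorm (blk A t τ) ≤ k * gu (((t : ℤ) - τ : ℤ) : ℝ) ^ (-κ)) :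
    ∃ T : HpI HalfLine p →L[ℝ] HpI HalfLine p, Banded T m ∧
      ‖A - T‖ ≤ k * ∑' r, tailWeight κ m r := by
  have hz : specNorm (0 : Matrix (Fin p) (Fin p) ℝ) = 0 := by simp [specNorm]
  have ha0 : ∀ r : ℤ, 0 ≤ k * gu (r : ℝ) ^ (-κ) := fun r =>
    mul_nonneg hk (Real.rpow_nonneg (gu_pos _).le _)
  obtain ⟨T, -, hT⟩ := exists_operator_of_blocks ((summable_gu_rpow_neg hκ).mul_left k)
    (fun t τ => if (m : ℤ) < |(t : ℤ) - τ| then 0 else blk A t τ)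
    (fun t τ => by
      split_ifs with h
      · rw [hz]; exact ha0 _
      · exact hA t τ) ha0
  refine ⟨T, fun t τ h y => ?_, ?_⟩
  · rw [hT, if_pos h]
    simp
  · rw [← tsum_mul_left]
    refine norm_le_tsum_of_blocks ((summable_tailWeight_and_tsum_le hκ m).1.mul_left k)
      (fun r => mul_nonneg hk (tailWeight_nonneg κ m r)) _ fun t τ => ?_
    rw [blk_sub, blk_eq_of_apply_single (hT t τ)]
    unfold tailWeight
    split_ifs with h
    · simpa using hA t τ
    · simp [hz]

/-- Inverses of uniformly coercive operators with polynomially decaying blocks are approximated by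
banded operators. -/
theorem exists_banded_approx_inverse {κ k l : ℝ} (hκ : 2 ≤ κ) (hk : 0 ≤ k) (hl : 0 < l) :
    ∃ c : ℝ, 0 < c ∧ ∀ j : ℕ, 1 ≤ j → ∃ n m : ℕ, (2 * n + 1) * m < j ∧
      ∑' r, tailWeight κ m r ≤ c * zeta j ^ (κ - 1) ∧
      ∀ (p : ℕ) (A D : HpI HalfLine p →L[ℝ] HpI HalfLine p),
        (∀ v, l * ‖v‖ ^ 2 ≤ inner (𝕜 := ℝ) v (A v)) → A * D = 1 → D * A = 1 →
        (∀ t τ : HalfLine, specNorm (blk A t τ) ≤ k * gu (((t : ℤ) - τ : ℤ) : ℝ) ^ (-κ)) →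
        ∃ P : HpI HalfLine p →L[ℝ] HpI HalfLine p, Banded P (n * m) ∧
          ‖D - P‖ ≤ c * zeta j ^ (κ - 1) := by
  set L₀ := ∑' r : ℤ, gu (r : ℝ) ^ (-κ) with hL₀
  have hL₀0 : 0 ≤ L₀ := tsum_nonneg fun r => Real.rpow_nonneg (gu_pos _).le _
  set L := k * L₀ + l with hL
  have hlL : l ≤ L := by have : 0 ≤ k * L₀ := by positivity
                         linarith
  have hLpos : 0 < L := hl.trans_le hlL
  set q₀ := √(1 - l ^ 2 / L ^ 2) with hq₀
  have hq₀0 : 0 ≤ q₀ := Real.sqrt_nonneg _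
  have hq₀1 : q₀ < 1 := by
    rw [hq₀, Real.sqrt_lt' one_pos]
    have : 0 < l ^ 2 / L ^ 2 := by positivity
    linarith
  set q := (1 + q₀) / 2 with hq
  have hq0 : 0 < q := by linarith
  have hq1 : q < 1 := by linarith
  obtain ⟨c₁, hc₁, hpar⟩ := exists_order_bandwidth (s := κ - 1) (by linarith) hq0 hq1
  set c₂ := 2 * 2 ^ κ * c₁ with hc₂
  have hc₂0 : 0 < c₂ := by positivity
  set d := l / L ^ 2 * (k * c₂) * (1 - q)⁻¹ with hd
  have h1q : 0 < 1 - q := by linarith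
  have hd0 : 0 ≤ d := by positivity
  refine ⟨c₂ + l⁻¹ * (1 + d), by positivity, fun j hj => ?_⟩
  obtain ⟨n, m, hnm, hqn, hm⟩ := hpar j hj
  set z := zeta j ^ (κ - 1) with hz
  have hz0 : 0 < z := Real.rpow_pos_of_pos (zeta_pos _) _
  have htail : ∑' r, tailWeight κ m r ≤ c₂ * z := by
    refine (summable_tailWeight_and_tsum_le hκ m).2.trans ?_
    rw [hc₂, mul_assoc _ c₁]
    gcongr
  have hx : 0 ≤ l⁻¹ * (1 + d) * z := by positivity
  have hy : 0 ≤ c₂ * z := by positivity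
  refine ⟨n, m, hnm, by linarith, fun p A D hA hAD hDA hblk => ?_⟩
  have hD := norm_le_inv_of_coercive hl hA hAD
  obtain ⟨B, hBm, hB⟩ := exists_banded_truncation hκ hk m A hblk
  have hAL : ‖A‖ ≤ L := by
    have := norm_le_tsum_of_blocks ((summable_gu_rpow_neg hκ).mul_left k)
      (fun r => mul_nonneg hk (Real.rpow_nonneg (gu_pos _).le _)) A hblk
    rw [tsum_mul_left] at this
    linarith
  have hG₀ := norm_one_sub_smul_le_sqrt hl hlL hA hAL
  rw [← hq₀] at hG₀
  set ε := l / L ^ 2 * (k * (c₂ * z)) with hε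
  have hdiff : ‖1 - (l / L ^ 2) • A - (1 - (l / L ^ 2) • B)‖ ≤ ε := by
    have : 1 - (l / L ^ 2) • A - (1 - (l / L ^ 2) • B) = -((l / L ^ 2) • (A - B)) := by
      rw [smul_sub]; abel
    rw [this, norm_neg, norm_smul, Real.norm_of_nonneg (by positivity), hε]
    gcongr
    exact hB.trans (by gcongr)
  have hεd : ε * (1 - q)⁻¹ = d * z := by rw [hε, hd]; ring
  by_cases hcase : ε ≤ 1 - q
  · have hG : ‖1 - (l / L ^ 2) • B‖ ≤ q := by
      calc _ = ‖(1 - (l / L ^ 2) • A) - (1 - (l / L ^ 2) • A - (1 - (l / L ^ 2) • B))‖ := by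
            rw [sub_sub_cancel]
        _ ≤ q₀ + (1 - q) := (norm_sub_le _ _).trans (add_le_add hG₀ (hdiff.trans hcase))
        _ = q := by rw [hq]; ring
    have hmain := norm_sub_smul_geom_sum_le hDA hG hq0.le hq1 hdiff n
    refine ⟨_, ((((Banded.one m).sub (hBm.smul (l / L ^ 2))).geom_sum n).smul (l / L ^ 2)),
      hmain.trans ?_⟩
    rw [hεd]
    calc _ ≤ l⁻¹ * (z + d * z) := by gcongr
      _ = l⁻¹ * (1 + d) * z := by ring
      _ ≤ _ := by rw [add_mul]; linarith
  · refine ⟨0, Banded.zero _, ?_⟩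
    rw [sub_zero]
    have : 1 ≤ d * z := by
      rw [← hεd, ← div_eq_mul_inv, one_le_div h1q]
      exact (not_le.1 hcase).le
    calc ‖D‖ ≤ l⁻¹ * 1 := by rw [mul_one]; exact hD
      _ ≤ l⁻¹ * (z + d * z) := by gcongr; linarith
      _ = l⁻¹ * (1 + d) * z := by ring
      _ ≤ _ := by rw [add_mul _ _ z]; linarith

section Coercivity

theorem inner_sum_single_apply {ι κ : Type} [DecidableEq ι] {p : ℕ} (A : HpI ι p →L[ℝ] HpI ι p)
    (s : Finset κ) (e : κ → ι) (x : κ → EuclideanSpace ℝ (Fin p)) :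
    inner (𝕜 := ℝ) (∑ t ∈ s, (lp.single 2 (e t) (x t) : HpI ι p))
        (A (∑ t ∈ s, (lp.single 2 (e t) (x t) : HpI ι p))) =
      ∑ t ∈ s, ∑ τ ∈ s, inner (𝕜 := ℝ) (x t) (matCLM (blk A (e t) (e τ)) (x τ)) := by
  rw [map_sum, sum_inner]
  refine Finset.sum_congr rfl fun t _ => ?_
  rw [inner_sum]
  refine Finset.sum_congr rfl fun τ _ => ?_
  rw [lp.inner_single_left, apply_single_eq]

theorem norm_sq_sum_single {ι κ : Type} [DecidableEq ι] {p : ℕ}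
    (s : Finset κ) {e : κ → ι} (he : Function.Injective e) (x : κ → EuclideanSpace ℝ (Fin p)) :
    ‖∑ t ∈ s, (lp.single 2 (e t) (x t) : HpI ι p)‖ ^ 2 = ∑ t ∈ s, ‖x t‖ ^ 2 := by
  rw [← real_inner_self_eq_norm_sq, sum_inner]
  refine Finset.sum_congr rfl fun t ht => ?_
  rw [inner_sum, Finset.sum_eq_single_of_mem t ht]
  · rw [lp.inner_single_left, lp.single_apply_self, real_inner_self_eq_norm_sq]
  · intro τ _ hτ
    rw [lp.inner_single_left, lp.single_apply_ne (E := fun _ => EuclideanSpace ℝ (Fin p)),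
      inner_zero_right]
    exact fun h => hτ (he h).symm

theorem gu_rpow_le_one (x : ℝ) {s : ℝ} (hs : s ≤ 0) : gu x ^ s ≤ 1 :=
  Real.rpow_le_one_of_one_le_of_nonpos (one_le_gu x) hs

variable {p : ℕ} {K κ lamInf lamSup : ℝ} {N₀ : ℕ} {C : ℕ → Hp p →L[ℝ] Hp p}
  {Cr : ℤ → ℝ → Matrix (Fin p) (Fin p) ℝ}

theorem AssumptionLS.nonneg (h : AssumptionLS p K κ lamInf lamSup N₀ C Cr) : 0 ≤ K := by
  have h1 : 0 ≤ specNorm (Cr 0 0) := norm_nonneg _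
  have h2 := h1.trans (h.crBound 0 0)
  exact nonneg_of_mul_nonneg_left h2 (Real.rpow_pos_of_pos (gu_pos _) _)

theorem AssumptionLS.specNorm_blk_shift_sub_le (h : AssumptionLS p K κ lamInf lamSup N₀ C Cr)
    (hκ : 1 ≤ κ) (u : ℝ) {N : ℕ} (hN : 1 ≤ N) (t τ : ℤ) :
    specNorm (blk (C N) (t + ⌊u * N⌋) (τ + ⌊u * N⌋) - Cr (t - τ) u) ≤
      K * (|(t : ℝ)| + 2) / N := by
  have hK := h.nonneg
  have hN0 : (0 : ℝ) < N := by exact_mod_cast hN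
  set T := ⌊u * N⌋ with hT
  have h1 := h.approx N hN (t + T) (τ + T)
  have h2 := h.crLip (t - τ) (((t + T : ℤ) : ℝ) / N) u
  rw [add_sub_add_right_eq_sub] at h1
  have h1' : specNorm (blk (C N) (t + T) (τ + T) - Cr (t - τ) (((t + T : ℤ) : ℝ) / N)) ≤
      K * 1 * (1 / N) :=
    h1.trans (mul_le_mul (mul_le_mul_of_nonneg_left (gu_rpow_le_one _ (by linarith)) hK)
      (min_le_left _ _) (le_min (by positivity) (div_nonneg (by norm_num) (gu_pos _).le))
      (by positivity))
  have h3 : |((t + T : ℤ) : ℝ) / N - u| ≤ (|(t : ℝ)| + 1) / N := by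
    have hfl := Int.floor_le (u * N)
    have hfl' := Int.lt_floor_add_one (u * N)
    have : ((t + T : ℤ) : ℝ) / N - u = ((t : ℝ) + (T - u * N)) / N := by
      push_cast
      field_simp
      ring
    rw [this, abs_div, abs_of_pos hN0]
    gcongr
    refine (abs_add_le _ _).trans ?_
    gcongr
    rw [abs_le]
    constructor <;> linarith
  have h2' : specNorm (Cr (t - τ) (((t + T : ℤ) : ℝ) / N) - Cr (t - τ) u) ≤
      K * ((|(t : ℝ)| + 1) / N) * 1 :=
    h2.trans (mul_le_mul (mul_le_mul_of_nonneg_left h3 hK) (gu_rpow_le_one _ (by linarith))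
      (Real.rpow_nonneg (gu_pos _).le _) (by positivity))
  have htri : specNorm (blk (C N) (t + T) (τ + T) - Cr (t - τ) u) ≤
      specNorm (blk (C N) (t + T) (τ + T) - Cr (t - τ) (((t + T : ℤ) : ℝ) / N)) +
        specNorm (Cr (t - τ) (((t + T : ℤ) : ℝ) / N) - Cr (t - τ) u) := by
    unfold specNorm
    rw [map_sub, map_sub, map_sub, map_sub, map_sub, map_sub]
    exact norm_sub_le_norm_sub_add_norm_sub _ _ _
  refine htri.trans ((add_le_add h1' h2').trans (le_of_eq ?_))
  field_simp
  ring

/-- Coercivity passes from the operators `C N` to the compressed block Toeplitz operator, by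
testing against shifted finitely supported sequences. -/
theorem AssumptionLS.coercive (h : AssumptionLS p K κ lamInf lamSup N₀ C Cr) (hκ : 1 ≤ κ)
    (u : ℝ) (A : HpI HalfLine p →L[ℝ] HpI HalfLine p)
    (hA : ∀ t τ : HalfLine, blk A t τ = Cr ((t : ℤ) - τ) u) (v : HpI HalfLine p) :
    lamInf * ‖v‖ ^ 2 ≤ inner (𝕜 := ℝ) v (A v) := by
  have hfin : ∀ s : Finset HalfLine,
      lamInf * ‖∑ t ∈ s, (lp.single 2 t (v t) : HpI HalfLine p)‖ ^ 2 ≤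
        inner (𝕜 := ℝ) (∑ t ∈ s, (lp.single 2 t (v t) : HpI HalfLine p))
          (A (∑ t ∈ s, (lp.single 2 t (v t) : HpI HalfLine p))) := fun s => by
    rw [inner_sum_single_apply A s (fun t => t) v,
      norm_sq_sum_single s (e := fun t : HalfLine => t) Function.injective_id v]
    set B := ∑ t ∈ s, ∑ τ ∈ s, ‖v t‖ * (K * (|((t : ℤ) : ℝ)| + 2) * ‖v τ‖) with hB
    set Q := ∑ t ∈ s, ∑ τ ∈ s, inner (𝕜 := ℝ) (v t) (matCLM (blk A t τ) (v τ)) with hQ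
    have hlim : Filter.Tendsto (fun N : ℕ => Q + B / N) Filter.atTop (nhds (Q + 0)) :=
      tendsto_const_nhds.add (tendsto_const_div_atTop_nhds_zero_nat B)
    rw [add_zero] at hlim
    refine ge_of_tendsto hlim (Filter.eventually_atTop.2 ⟨max 1 N₀, fun N hN => ?_⟩)
    have hN1 : 1 ≤ N := (le_max_left _ _).trans hN
    have hlow := h.lower N ((le_max_right _ _).trans hN)
      (∑ t ∈ s, (lp.single 2 ((t : ℤ) + ⌊u * N⌋) (v t) : HpI ℤ p))
    have hinj : Function.Injective fun t : HalfLine => (t : ℤ) + ⌊u * N⌋ := fun a b hab =>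
      Subtype.ext (by simpa using hab)
    have e1 := norm_sq_sum_single (p := p) s hinj v
    have e2 := inner_sum_single_apply (C N) s (fun t : HalfLine => (t : ℤ) + ⌊u * N⌋) v
    rw [e1, e2] at hlow
    refine hlow.trans ?_
    rw [hQ, hB, Finset.sum_div, ← Finset.sum_add_distrib]
    refine Finset.sum_le_sum fun t _ => ?_
    rw [Finset.sum_div, ← Finset.sum_add_distrib]
    refine Finset.sum_le_sum fun τ _ => ?_
    rw [← sub_le_iff_le_add', ← inner_sub_right, hA]
    refine (real_inner_le_norm _ _).trans ?_
    rw [mul_div_assoc, mul_div_right_comm]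
    gcongr
    have := h.specNorm_blk_shift_sub_le hκ u hN1 t τ
    unfold specNorm at this
    rw [map_sub, map_sub] at this
    exact ContinuousLinearMap.le_of_opNorm_le _ this (v τ)
  have hv : Filter.Tendsto (fun s : Finset HalfLine =>
      ∑ t ∈ s, (lp.single 2 t (v t) : HpI HalfLine p)) Filter.atTop (nhds v) :=
    lp.hasSum_single (p := 2) (by norm_num) v
  exact le_of_tendsto_of_tendsto' ((hv.norm.pow 2).const_mul lamInf)
    (hv.inner ((A.continuous.tendsto v).comp hv)) hfin

end Coercivity

section MatrixBounds

variable {p : ℕ}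

theorem matCLM_mul (M N : Matrix (Fin p) (Fin p) ℝ) : matCLM (M * N) = matCLM M * matCLM N := by
  ext1 y
  simp [matCLM, Matrix.toLpLin_apply, Matrix.mulVec_mulVec]

theorem specNorm_mul_le (M N : Matrix (Fin p) (Fin p) ℝ) :
    specNorm (M * N) ≤ specNorm M * specNorm N := by
  change ‖matCLM (M * N)‖ ≤ ‖matCLM M‖ * ‖matCLM N‖
  rw [matCLM_mul]
  exact norm_mul_le _ _

theorem specNorm_nonneg (M : Matrix (Fin p) (Fin p) ℝ) : 0 ≤ specNorm M := norm_nonneg _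

theorem specNorm_add_le (M N : Matrix (Fin p) (Fin p) ℝ) :
    specNorm (M + N) ≤ specNorm M + specNorm N := by
  unfold specNorm
  rw [map_add, map_add]
  exact norm_add_le _ _

theorem specNorm_neg (M : Matrix (Fin p) (Fin p) ℝ) : specNorm (-M) = specNorm M := by
  unfold specNorm
  rw [map_neg, map_neg, norm_neg]

theorem isUnit_det_and_specNorm_inv_le {S : Matrix (Fin p) (Fin p) ℝ} {l : ℝ} (hl : 0 < l)
    (hS : ∀ x, l * ‖x‖ ^ 2 ≤ inner (𝕜 := ℝ) x (matCLM S x)) :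
    IsUnit S.det ∧ specNorm S⁻¹ ≤ l⁻¹ := by
  have hdet : IsUnit S.det := by
    rw [isUnit_iff_ne_zero]
    intro h0
    obtain ⟨v, hv, hv0⟩ := Matrix.exists_mulVec_eq_zero_iff.2 h0
    have h1 := hS (WithLp.toLp 2 v)
    have h2 : matCLM S (WithLp.toLp 2 v) = 0 := by
      simp [matCLM, hv0]
    rw [h2, inner_zero_right] at h1
    have h3 : (WithLp.toLp 2 v : EuclideanSpace ℝ (Fin p)) ≠ 0 := by simpa using hv
    have : 0 < ‖(WithLp.toLp 2 v : EuclideanSpace ℝ (Fin p))‖ := norm_pos_iff.2 h3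
    have : 0 < l * ‖(WithLp.toLp 2 v : EuclideanSpace ℝ (Fin p))‖ ^ 2 := by positivity
    linarith
  refine ⟨hdet, norm_le_inv_of_coercive (A := matCLM S) (D := matCLM S⁻¹) hl hS ?_⟩
  rw [← matCLM_mul, Matrix.mul_nonsing_inv _ hdet]
  ext1 y
  simp [matCLM]

theorem specNorm_inv_sub_inv_le {S T : Matrix (Fin p) (Fin p) ℝ} {l : ℝ} (hl : 0 < l)
    (hS : ∀ x, l * ‖x‖ ^ 2 ≤ inner (𝕜 := ℝ) x (matCLM S x))
    (hT : ∀ x, l * ‖x‖ ^ 2 ≤ inner (𝕜 := ℝ) x (matCLM T x)) :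
    specNorm (S⁻¹ - T⁻¹) ≤ l⁻¹ * specNorm (S - T) * l⁻¹ := by
  obtain ⟨hSd, hSn⟩ := isUnit_det_and_specNorm_inv_le hl hS
  obtain ⟨hTd, hTn⟩ := isUnit_det_and_specNorm_inv_le hl hT
  have : S⁻¹ - T⁻¹ = -(S⁻¹ * (S - T) * T⁻¹) := by
    rw [mul_sub, sub_mul, Matrix.nonsing_inv_mul _ hSd, one_mul, mul_assoc,
      Matrix.mul_nonsing_inv _ hTd, mul_one, neg_sub]
  rw [this, specNorm_neg]
  have h0 := specNorm_nonneg (S - T)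
  have h1 := specNorm_nonneg T⁻¹
  calc _ ≤ specNorm S⁻¹ * specNorm (S - T) * specNorm T⁻¹ :=
        (specNorm_mul_le _ _).trans (mul_le_mul_of_nonneg_right (specNorm_mul_le _ _) h1)
    _ ≤ _ := by gcongr

end MatrixBounds

section Inverse

variable {p : ℕ} {A D : HpI HalfLine p →L[ℝ] HpI HalfLine p}

theorem blk_coercive {l : ℝ} (hA : ∀ v, l * ‖v‖ ^ 2 ≤ inner (𝕜 := ℝ) v (A v)) (t : HalfLine)
    (x : EuclideanSpace ℝ (Fin p)) :
    l * ‖x‖ ^ 2 ≤ inner (𝕜 := ℝ) x (matCLM (blk A t t) x) := by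
  have := hA (lp.single 2 t x)
  rwa [lp.inner_single_left, apply_single_eq, lp.norm_single (by norm_num)] at this

theorem inverse_coercive {l L : ℝ} (hl : 0 ≤ l) (hL0 : 0 < L) (hL : ‖A‖ ≤ L)
    (hA : ∀ v, l * ‖v‖ ^ 2 ≤ inner (𝕜 := ℝ) v (A v)) (hAD : A * D = 1)
    (v : HpI HalfLine p) : l / L ^ 2 * ‖v‖ ^ 2 ≤ inner (𝕜 := ℝ) v (D v) := by
  have h1 : A (D v) = v :=
    congrArg (fun F : HpI HalfLine p →L[ℝ] HpI HalfLine p => F v) hAD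
  have h2 := hA (D v)
  rw [h1, real_inner_comm] at h2
  refine le_trans ?_ h2
  have h3 : ‖v‖ ≤ L * ‖D v‖ := by
    have := A.le_of_opNorm_le hL (D v)
    rwa [h1] at this
  have h4 : ‖v‖ ^ 2 ≤ L ^ 2 * ‖D v‖ ^ 2 := by rw [← mul_pow]; gcongr
  calc _ ≤ l / L ^ 2 * (L ^ 2 * ‖D v‖ ^ 2) := by gcongr
    _ = _ := by field_simp

end Inverse

set_option maxHeartbeats 1000000 in
/-- Theorem 3.6(ii): Lipschitz continuity of the stationary VAR(∞) parameters
`Σ(u) = ([𝐂(−∞,0; u)⁻¹]_{0,0})⁻¹` and `Φ_j(u) = −Σ(u) [𝐂(−∞,0; u)⁻¹]_{0,−j}`, where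
`𝐂(−∞,0; u)` is the compression of the block Toeplitz operator `𝐂(u)` to
`ℓ²({t ≤ 0}; ℝ^p)` (characterised by its blocks) and `𝐃(u)` denotes its inverse. -/
theorem var_parameters_lipschitz (K κ lamInf lamSup : ℝ) (N₀ : ℕ)
    (hκ : 3 < κ) (hInf : 0 < lamInf) (hle : lamInf ≤ lamSup) :
    ∃ 𝒦 : ℝ, 0 < 𝒦 ∧
      ∀ (p : ℕ), 1 ≤ p →
        ∀ (C : ℕ → Hp p →L[ℝ] Hp p) (Cr : ℤ → ℝ → Matrix (Fin p) (Fin p) ℝ),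
          AssumptionLS p K κ lamInf lamSup N₀ C Cr →
          ∀ (u₁ u₂ : ℝ)
            (CU₁ DU₁ CU₂ DU₂ :
              HpI {t : ℤ // t ≤ (0 : ℤ)} p →L[ℝ] HpI {t : ℤ // t ≤ (0 : ℤ)} p),
            (∀ t τ : {t : ℤ // t ≤ (0 : ℤ)}, blk CU₁ t τ = Cr ((t : ℤ) - (τ : ℤ)) u₁) →
            CU₁.comp DU₁ = ContinuousLinearMap.id ℝ _ →
            DU₁.comp CU₁ = ContinuousLinearMap.id ℝ _ →
            (∀ t τ : {t : ℤ // t ≤ (0 : ℤ)}, blk CU₂ t τ = Cr ((t : ℤ) - (τ : ℤ)) u₂) →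
            CU₂.comp DU₂ = ContinuousLinearMap.id ℝ _ →
            DU₂.comp CU₂ = ContinuousLinearMap.id ℝ _ →
            specNorm ((blk DU₁ ⟨0, le_refl 0⟩ ⟨0, le_refl 0⟩)⁻¹ -
                (blk DU₂ ⟨0, le_refl 0⟩ ⟨0, le_refl 0⟩)⁻¹) ≤ 𝒦 * |u₁ - u₂| ∧
            ∀ j : ℕ, 1 ≤ j →
              specNorm
                (-(blk DU₁ ⟨0, le_refl 0⟩ ⟨0, le_refl 0⟩)⁻¹ *
                    blk DU₁ ⟨0, le_refl 0⟩ ⟨-(j : ℤ), by omega⟩ -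
                  -(blk DU₂ ⟨0, le_refl 0⟩ ⟨0, le_refl 0⟩)⁻¹ *
                    blk DU₂ ⟨0, le_refl 0⟩ ⟨-(j : ℤ), by omega⟩) ≤
                𝒦 * zeta (j : ℝ) ^ (κ - 1) * |u₁ - u₂| := by
  have hκ2 : 2 ≤ κ := by linarith
  set k := |K| with hk
  have hk0 : 0 ≤ k := abs_nonneg K
  set L₀ := ∑' r : ℤ, gu (r : ℝ) ^ (-κ) with hL₀
  have hL₀0 : 0 ≤ L₀ := tsum_nonneg fun r => Real.rpow_nonneg (gu_pos _).le _
  set L := k * L₀ + lamInf with hL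
  have hLpos : 0 < L := by positivity
  obtain ⟨c, hc, happrox⟩ := exists_banded_approx_inverse hκ2 hk0 hInf
  set a := (lamInf / L ^ 2)⁻¹ with ha
  have ha0 : 0 < a := by positivity
  set i := lamInf⁻¹ with hi
  have hi0 : 0 < i := by positivity
  set e₀ := i * (k * L₀) * i with he₀
  set e₁ := c * (k * L₀) * i + (i + c) * (k * c) * i + (i + c) * (k * (L₀ + c)) * c with he₁
  have he₀0 : 0 ≤ e₀ := by positivity
  have he₁0 : 0 ≤ e₁ := by positivity
  refine ⟨a * e₀ * a + (a * e₀ * a * c + a * e₁) + 1, by positivity, ?_⟩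
  intro p _ C Cr hLS u₁ u₂ A₁ D₁ A₂ D₂ hA₁ hAD₁ hDA₁ hA₂ hAD₂ hDA₂
  change A₁ * D₁ = 1 at hAD₁
  change D₁ * A₁ = 1 at hDA₁
  change A₂ * D₂ = 1 at hAD₂
  change D₂ * A₂ = 1 at hDA₂
  set o : HalfLine := ⟨0, le_refl 0⟩ with ho
  set Δ := |u₁ - u₂| with hΔ
  have hΔ0 : 0 ≤ Δ := abs_nonneg _
  have hg0 : ∀ r : ℤ, 0 ≤ gu (r : ℝ) ^ (-κ) := fun r => Real.rpow_nonneg (gu_pos _).le _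
  have hblk : ∀ (A : HpI HalfLine p →L[ℝ] HpI HalfLine p) (u : ℝ),
      (∀ t τ : HalfLine, blk A t τ = Cr ((t : ℤ) - τ) u) → ∀ t τ : HalfLine,
        specNorm (blk A t τ) ≤ k * gu (((t : ℤ) - τ : ℤ) : ℝ) ^ (-κ) := fun A u h t τ => by
    rw [h]
    exact (hLS.crBound _ _).trans (mul_le_mul_of_nonneg_right (le_abs_self K) (hg0 _))
  have hb₁ := hblk A₁ u₁ hA₁
  have hb₂ := hblk A₂ u₂ hA₂
  have hnorm : ∀ (b : ℝ) (A : HpI HalfLine p →L[ℝ] HpI HalfLine p), 0 ≤ b →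
      (∀ t τ : HalfLine, specNorm (blk A t τ) ≤ b * gu (((t : ℤ) - τ : ℤ) : ℝ) ^ (-κ)) →
        ‖A‖ ≤ b * L₀ := fun b A hb h => by
    rw [hL₀, ← tsum_mul_left]
    exact norm_le_tsum_of_blocks ((summable_gu_rpow_neg hκ2).mul_left b)
      (fun r => mul_nonneg hb (hg0 r)) A h
  have hco₁ := hLS.coercive (by linarith) u₁ A₁ hA₁
  have hco₂ := hLS.coercive (by linarith) u₂ A₂ hA₂
  have hD₁ : ‖D₁‖ ≤ i := norm_le_inv_of_coercive hInf hco₁ hAD₁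
  have hD₂ : ‖D₂‖ ≤ i := norm_le_inv_of_coercive hInf hco₂ hAD₂
  have hS₁ := blk_coercive (inverse_coercive hInf.le hLpos
    ((hnorm k A₁ hk0 hb₁).trans (by linarith)) hco₁ hAD₁) o
  have hS₂ := blk_coercive (inverse_coercive hInf.le hLpos
    ((hnorm k A₂ hk0 hb₂).trans (by linarith)) hco₂ hAD₂) o
  have hl' : 0 < lamInf / L ^ 2 := by positivity
  have hX : ∀ t τ : HalfLine,
      specNorm (blk (A₂ - A₁) t τ) ≤ k * Δ * gu (((t : ℤ) - τ : ℤ) : ℝ) ^ (-κ) := fun t τ => by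
    rw [blk_sub, hA₁, hA₂]
    refine (hLS.crLip _ _ _).trans ?_
    rw [abs_sub_comm u₂ u₁]
    exact mul_le_mul_of_nonneg_right (mul_le_mul_of_nonneg_right (le_abs_self K) hΔ0) (hg0 _)
  have hXn := hnorm (k * Δ) _ (by positivity) hX
  have hres : D₁ - D₂ = D₁ * (A₂ - A₁) * D₂ := by
    rw [mul_sub, sub_mul, hDA₁, one_mul, mul_assoc, hAD₂, mul_one]
  have hE : ‖D₁ - D₂‖ ≤ e₀ * Δ := by
    rw [hres]
    calc _ ≤ ‖D₁‖ * ‖A₂ - A₁‖ * ‖D₂‖ :=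
          (norm_mul_le _ _).trans (mul_le_mul_of_nonneg_right (norm_mul_le _ _) (norm_nonneg _))
      _ ≤ i * (k * Δ * L₀) * i := by gcongr
      _ = e₀ * Δ := by rw [he₀]; ring
  have hInvSub : specNorm ((blk D₁ o o)⁻¹ - (blk D₂ o o)⁻¹) ≤ a * e₀ * a * Δ := by
    refine (specNorm_inv_sub_inv_le hl' hS₁ hS₂).trans ?_
    rw [← blk_sub, ← ha]
    calc _ ≤ a * (e₀ * Δ) * a := by
          gcongr
          exact (specNorm_blk_le _ _ _).trans hE
      _ = _ := by ring
  refine ⟨hInvSub.trans ?_, fun j hj => ?_⟩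
  · gcongr
    have : 0 ≤ a * e₀ * a * c + a * e₁ := by positivity
    linarith
  set τ : HalfLine := ⟨-(j : ℤ), by omega⟩ with hτ
  obtain ⟨n, m, hnm, htail, hP⟩ := happrox j hj
  set z := zeta j ^ (κ - 1) with hz
  have hz0 : 0 < z := Real.rpow_pos_of_pos (zeta_pos _) _
  have hz1 : z ≤ 1 := Real.rpow_le_one (zeta_pos _).le (zeta_le_one _) (by linarith)
  obtain ⟨P₁, hP₁b, hP₁⟩ := hP p A₁ D₁ hco₁ hAD₁ hDA₁ hb₁
  obtain ⟨P₂, hP₂b, hP₂⟩ := hP p A₂ D₂ hco₂ hAD₂ hDA₂ hb₂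
  obtain ⟨T, hTb, hT⟩ := exists_banded_truncation hκ2 (by positivity) m _ hX
  have hT' : ‖A₂ - A₁ - T‖ ≤ k * Δ * (c * z) := hT.trans (by gcongr)
  have hdist : |((o : HalfLine) : ℤ) - (τ : HalfLine)| = j := by simp [ho, hτ]
  have hdec : specNorm (blk D₁ o τ) ≤ c * z := by
    refine (hP₁b.specNorm_blk_le_norm_sub ?_).trans hP₁
    rw [hdist]
    have : n * m ≤ (2 * n + 1) * m := Nat.mul_le_mul_right _ (by omega)
    exact_mod_cast this.trans_lt hnm
  have hP₁n : ‖P₁‖ ≤ i + c := by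
    have h1 : ‖P₁‖ ≤ ‖D₁‖ + ‖D₁ - P₁‖ := norm_le_norm_add_norm_sub _ _
    have h2 : c * z ≤ c := mul_le_of_le_one_right hc.le hz1
    linarith
  have hTn : ‖T‖ ≤ k * Δ * (L₀ + c) := by
    have h1 : ‖T‖ ≤ ‖A₂ - A₁‖ + ‖A₂ - A₁ - T‖ := norm_le_norm_add_norm_sub _ _
    have h2 : k * Δ * (c * z) ≤ k * Δ * c := by
      gcongr
      exact mul_le_of_le_one_right hc.le hz1
    linarith
  have hEdec : specNorm (blk (D₁ - D₂) o τ) ≤ e₁ * z * Δ := by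
    refine (((hP₁b.mul hTb).mul hP₂b).specNorm_blk_le_norm_sub ?_).trans ?_
    · rw [hdist]
      have : n * m + m + n * m = (2 * n + 1) * m := by ring
      rw [this]
      exact_mod_cast hnm
    · have hsplit : D₁ - D₂ - P₁ * T * P₂ =
          (D₁ - P₁) * (A₂ - A₁) * D₂ + P₁ * (A₂ - A₁ - T) * D₂ + P₁ * T * (D₂ - P₂) := by
        rw [hres]
        noncomm_ring
      have h3 : ∀ X Y Z : HpI HalfLine p →L[ℝ] HpI HalfLine p,
          ‖X * Y * Z‖ ≤ ‖X‖ * ‖Y‖ * ‖Z‖ := fun X Y Z =>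
        (norm_mul_le _ _).trans (mul_le_mul_of_nonneg_right (norm_mul_le _ _) (norm_nonneg _))
      rw [hsplit]
      calc _ ≤ ‖D₁ - P₁‖ * ‖A₂ - A₁‖ * ‖D₂‖ + ‖P₁‖ * ‖A₂ - A₁ - T‖ * ‖D₂‖ +
              ‖P₁‖ * ‖T‖ * ‖D₂ - P₂‖ :=
            (norm_add₃_le).trans (add_le_add (add_le_add (h3 _ _ _) (h3 _ _ _)) (h3 _ _ _))
        _ ≤ c * z * (k * Δ * L₀) * i + (i + c) * (k * Δ * (c * z)) * i +
              (i + c) * (k * Δ * (L₀ + c)) * (c * z) := by gcongr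
        _ = e₁ * z * Δ := by rw [he₁]; ring
  have hsum : -(blk D₁ o o)⁻¹ * blk D₁ o τ - -(blk D₂ o o)⁻¹ * blk D₂ o τ =
      -(((blk D₁ o o)⁻¹ - (blk D₂ o o)⁻¹) * blk D₁ o τ +
        (blk D₂ o o)⁻¹ * blk (D₁ - D₂) o τ) := by
    rw [blk_sub]
    noncomm_ring
  rw [hsum, specNorm_neg]
  calc _ ≤ specNorm ((blk D₁ o o)⁻¹ - (blk D₂ o o)⁻¹) * specNorm (blk D₁ o τ) +
          specNorm (blk D₂ o o)⁻¹ * specNorm (blk (D₁ - D₂) o τ) :=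
        (specNorm_add_le _ _).trans (add_le_add (specNorm_mul_le _ _) (specNorm_mul_le _ _))
    _ ≤ a * e₀ * a * Δ * (c * z) + a * (e₁ * z * Δ) := by
        refine add_le_add (mul_le_mul hInvSub hdec (specNorm_nonneg _) (by positivity))
          (mul_le_mul (isUnit_det_and_specNorm_inv_le hl' hS₂).2 hEdec (specNorm_nonneg _) ha0.le)
    _ = (a * e₀ * a * c + a * e₁) * z * Δ := by ring
    _ ≤ _ := by
        have h1 : 0 ≤ a * e₀ * a := by positivity
        refine mul_le_mul_of_nonneg_right (mul_le_mul_of_nonneg_right ?_ hz0.le) hΔ0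
        linarith
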